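/- For integers r ≥ 1 and n ≥ 0 define vw(r,n) := Σ_{d} (1/d²)·c( r(n−r)/d² + 1 ), summed over positive common divisors d of r and n (each argument r(n−r)/d² + 1 = (r/d)(n/d) − (r/d)² + 1 being an integer). Then for every integer r ≥ 1 and every complex number x with 0 < |x| < 1: Σ_{n=0}^{∞} vw(r,n)·x^{r²n} = Σ_{d ∣ r} (d/r²)·x^{r³} · Σ_{j=0}^{d−1} (ζ_d^{j}·x^{r³/d²})^{−1} · ∏_{k=1}^{∞} (1 − (ζ_d^{j}·x^{r³/d²})^{k})^{−24}, where ζ_d = exp(2πi/d), the outer sum is over positive divisors d of r (so r³/d² is a positive integer), and all series and products converge absolutely. -/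

import Mathlib

/-- `cK3 n` = the number of 24-tuples `(λ₁,…,λ₂₄)` of integer partitions with
`|λ₁| + ⋯ + |λ₂₄| = n`. -/
noncomputable def cK3 (n : ℕ) : ℕ :=
  Nat.card {f : Fin 24 → Σ m : ℕ, Nat.Partition m // ∑ i, (f i).1 = n}

/-- Extension of `cK3` to the integers by `0` on negative numbers. -/
noncomputable def cK3Z (n : ℤ) : ℕ := if 0 ≤ n then cK3 n.toNat else 0

/-- The rank `r`, trivial determinant, second Chern class `n` Vafa–Witten invariant of a
polarised K3 surface: `vw(r,n) = Σ_d (1/d²) c(r(n−r)/d² + 1)`, summed over the positive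
common divisors `d` of `r` and `n` (each division being exact). -/
noncomputable def vwK3 (r n : ℕ) : ℚ :=
  ∑ d ∈ (Nat.gcd r n).divisors,
    (1 / (d : ℚ) ^ 2) * (cK3Z ((r : ℤ) * ((n : ℤ) - (r : ℤ)) / (d : ℤ) ^ 2 + 1) : ℚ)

open PowerSeries in
/-- absolutely convergent evaluation of a power series with natural coefficients -/
def K3Ev {K : Type} [RCLike K] (F : PowerSeries ℕ) (y a : K) : Prop :=
  Summable (fun n => ‖((coeff n F : ℕ) : K) * y ^ n‖) ∧
    ∑' n, ((coeff n F : ℕ) : K) * y ^ n = a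

open PowerSeries in
lemma K3Ev.mul {K : Type} [RCLike K] {F G : PowerSeries ℕ} {y a b : K}
    (hF : K3Ev F y a) (hG : K3Ev G y b) : K3Ev (F * G) y (a * b) := by
  have key : (fun n => ((coeff n (F * G) : ℕ) : K) * y ^ n) =
      fun n => ∑ kl ∈ Finset.HasAntidiagonal.antidiagonal n,
        (((coeff kl.1 F : ℕ) : K) * y ^ kl.1) * (((coeff kl.2 G : ℕ) : K) * y ^ kl.2) := by
    funext n
    rw [coeff_mul, Nat.cast_sum, Finset.sum_mul]
    refine Finset.sum_congr rfl fun kl h => ?_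
    rw [← Finset.HasAntidiagonal.mem_antidiagonal.1 h, pow_add]
    push_cast
    ring
  constructor
  · have := summable_norm_sum_mul_antidiagonal_of_summable_norm hF.1 hG.1
    exact this.congr fun n => by rw [← congrFun key n]
  · rw [key, ← tsum_mul_tsum_eq_tsum_sum_antidiagonal_of_summable_norm hF.1 hG.1, hF.2, hG.2]

open PowerSeries in
lemma K3Ev.one {K : Type} [RCLike K] (y : K) : K3Ev 1 y 1 := by
  have : ∀ n, n ∉ ({0} : Finset ℕ) → ((coeff n (1 : PowerSeries ℕ) : ℕ) : K) * y ^ n = 0 := by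
    intro n hn
    rw [coeff_one, if_neg (by simpa using hn)]
    simp
  constructor
  · exact summable_of_ne_finset_zero (s := {0}) fun n hn => by rw [this n hn, norm_zero]
  · rw [tsum_eq_sum this]; simp

lemma K3Ev.prod {K : Type} [RCLike K] {F : ℕ → PowerSeries ℕ} {y : K} {a : ℕ → K}
    (h : ∀ i, K3Ev (F i) y (a i)) (N : ℕ) :
    K3Ev (∏ i ∈ Finset.range N, F i) y (∏ i ∈ Finset.range N, a i) := by
  induction N with
  | zero => simpa using K3Ev.one y
  | succ N ih => rw [Finset.prod_range_succ, Finset.prod_range_succ]; exact ih.mul (h N)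

lemma K3Ev.pow {K : Type} [RCLike K] {F : PowerSeries ℕ} {y : K} {a : K}
    (h : K3Ev F y a) (N : ℕ) : K3Ev (F ^ N) y (a ^ N) := by
  induction N with
  | zero => simpa using K3Ev.one y
  | succ N ih => rw [pow_succ, pow_succ]; exact ih.mul h

/-- the geometric factor -/
def K3E (i : ℕ) : PowerSeries ℕ := PowerSeries.mk fun n => if (i + 1) ∣ n then 1 else 0

/-- partition generating series -/
def K3P : PowerSeries ℕ := PowerSeries.mk fun n => Fintype.card (Nat.Partition n)

lemma K3E_ev {K : Type} [RCLike K] (i : ℕ) {y : K} (hy : ‖y‖ < 1) :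
    K3Ev (K3E i) y (1 - y ^ (i + 1))⁻¹ := by
  have hy' : ‖y ^ (i + 1)‖ < 1 := by
    rw [norm_pow]; exact pow_lt_one₀ (norm_nonneg _) hy (by omega)
  have hinj : Function.Injective (fun j : ℕ => (i + 1) * j) := fun a b h =>
    Nat.eq_of_mul_eq_mul_left (Nat.succ_pos i) h
  have hz : ∀ n, n ∉ Set.range (fun j : ℕ => (i + 1) * j) →
      ((PowerSeries.coeff n (K3E i) : ℕ) : K) * y ^ n = 0 := by
    intro n hn
    have : ¬ (i + 1) ∣ n := fun ⟨j, hj⟩ => hn ⟨j, hj.symm⟩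
    simp [K3E, this]
  have hc : (fun n => ((PowerSeries.coeff n (K3E i) : ℕ) : K) * y ^ n) ∘
      (fun j : ℕ => (i + 1) * j) = fun j => (y ^ (i + 1)) ^ j := by
    funext j
    simp [K3E, pow_mul]
  constructor
  · rw [← hinj.summable_iff (fun n hn => by rw [hz n hn, norm_zero])]
    have := summable_geometric_of_lt_one (norm_nonneg _) hy'
    refine this.congr fun j => ?_
    have := congrFun hc j
    simp only [Function.comp_apply] at this ⊢
    rw [this, norm_pow (y ^ (i + 1))]
  · have h1 := hasSum_geometric_of_norm_lt_one hy'
    rw [← hc, hinj.hasSum_iff hz] at h1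
    exact h1.tsum_eq

open scoped PowerSeries.WithPiTopology in
lemma K3P_hasProd : HasProd K3E K3P := by
  have := Nat.Partition.hasProd_powerSeriesMk_card_restricted ℕ (fun _ => True)
  convert this using 1
  · funext i
    rw [if_pos trivial]
    symm
    apply HasSum.tsum_eq
    rw [PowerSeries.WithPiTopology.hasSum_iff_hasSum_coeff]
    intro n
    simp only [K3E, PowerSeries.coeff_mk, PowerSeries.coeff_X_pow]
    split_ifs with h
    · obtain ⟨j, rfl⟩ := h
      convert hasSum_single (f := fun j' : ℕ => if (i + 1) * j = (i + 1) * j' then (1 : ℕ) else 0)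
        j (fun j' hj' => if_neg fun h => hj' (Nat.eq_of_mul_eq_mul_left (Nat.succ_pos i) h).symm)
      · rfl
      · exact (if_pos rfl).symm
    · convert hasSum_zero using 2 with j'
      exact if_neg fun h' => h ⟨j', h'⟩
  · ext n
    simp [K3P, Nat.Partition.restricted]

/-- partial products -/
noncomputable def K3G (N : ℕ) : PowerSeries ℕ := ∏ i ∈ Finset.range N, K3E i

open scoped PowerSeries.WithPiTopology in
lemma K3G_eventually (m : ℕ) :
    ∀ᶠ N in Filter.atTop, PowerSeries.coeff m (K3G N) = PowerSeries.coeff m K3P := by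
  have h := K3P_hasProd.tendsto_prod_nat
  rw [PowerSeries.WithPiTopology.tendsto_iff_coeff_tendsto] at h
  have := h m
  rw [nhds_discrete, Filter.tendsto_pure] at this
  exact this

lemma K3G_mono (m : ℕ) : Monotone fun N => PowerSeries.coeff m (K3G N) := by
  refine monotone_nat_of_le_succ fun N => ?_
  simp only [K3G]
  rw [Finset.prod_range_succ, PowerSeries.coeff_mul]
  refine le_trans ?_ (Finset.single_le_sum (fun _ _ => Nat.zero_le _)
    (Finset.HasAntidiagonal.mem_antidiagonal.2 (add_zero m) : (m, 0) ∈ _))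
  simp [K3E]

lemma K3G_le (m N : ℕ) : PowerSeries.coeff m (K3G N) ≤ PowerSeries.coeff m K3P := by
  obtain ⟨M, hM, hM'⟩ := ((K3G_eventually m).and (Filter.eventually_ge_atTop N)).exists
  rw [← hM]
  exact K3G_mono m hM'

lemma K3_mult {K : Type} [RCLike K] {y : K} (hy : ‖y‖ < 1) :
    Multipliable fun k : ℕ => (1 - y ^ (k + 1))⁻¹ := by
  have hs : Summable fun n : ℕ => ‖-y ^ (n + 1)‖ := by
    simpa using (summable_nat_add_iff 1).mpr (summable_geometric_of_lt_one (norm_nonneg _) hy)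
  have h1 : Multipliable fun k : ℕ => (1 - y ^ (k + 1)) := by
    simpa [sub_eq_add_neg] using multipliable_one_add_of_summable hs
  refine h1.inv₀ ?_
  have := tprod_one_add_ne_zero_of_summable (f := fun n : ℕ => -y ^ (n + 1)) (fun i h => ?_) hs
  · simpa [sub_eq_add_neg] using this
  · have hy' : ‖y ^ (i + 1)‖ < 1 := by
      rw [norm_pow]; exact pow_lt_one₀ (norm_nonneg _) hy (by omega)
    have : y ^ (i + 1) = 1 := by linear_combination -h
    rw [this] at hy'
    simp at hy'

lemma K3P_summable {ρ : ℝ} (h0 : 0 ≤ ρ) (hρ : ρ < 1) :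
    Summable fun n => ((PowerSeries.coeff n K3P : ℕ) : ℝ) * ρ ^ n := by
  have hy : ‖ρ‖ < 1 := by rwa [Real.norm_of_nonneg h0]
  have ht := (K3_mult hy).hasProd.tendsto_prod_nat
  obtain ⟨B, hB⟩ := ht.bddAbove_range
  refine summable_of_sum_range_le (c := B) (fun n => by positivity) fun M => ?_
  have hev : ∀ᶠ N in Filter.atTop, ∀ m ∈ Finset.range M,
      PowerSeries.coeff m (K3G N) = PowerSeries.coeff m K3P := by
    rw [Filter.eventually_all_finset]
    exact fun m _ => K3G_eventually m
  obtain ⟨N, hN⟩ := hev.exists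
  have hg : K3Ev (K3G N) ρ _ := K3Ev.prod (fun i => K3E_ev i hy) N
  calc _ = ∑ n ∈ Finset.range M, ((PowerSeries.coeff n (K3G N) : ℕ) : ℝ) * ρ ^ n :=
        Finset.sum_congr rfl fun m hm => by rw [hN m hm]
    _ ≤ ∑' n, ((PowerSeries.coeff n (K3G N) : ℕ) : ℝ) * ρ ^ n :=
        hg.1.of_norm.sum_le_tsum _ fun n _ => by positivity
    _ ≤ B := by rw [hg.2]; exact hB ⟨N, rfl⟩

lemma K3P_ev {y : ℂ} (hy : ‖y‖ < 1) : K3Ev K3P y (∏' k : ℕ, (1 - y ^ (k + 1))⁻¹) := by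
  have hs := K3P_summable (norm_nonneg y) hy
  have hs' : Summable (fun n => ‖((PowerSeries.coeff n K3P : ℕ) : ℂ) * y ^ n‖) := by
    simpa using hs
  refine ⟨hs', ?_⟩
  have h1 := (K3_mult hy).hasProd.tendsto_prod_nat
  have h2 := tendsto_tsum_of_dominated_convergence (𝓕 := Filter.atTop)
    (f := fun N n => ((PowerSeries.coeff n (K3G N) : ℕ) : ℂ) * y ^ n)
    (g := fun n => ((PowerSeries.coeff n K3P : ℕ) : ℂ) * y ^ n) hs' (fun n => ?_)
    (Filter.Eventually.of_forall fun N n => ?_)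
  · refine tendsto_nhds_unique h2 (h1.congr fun N => ?_)
    exact (K3Ev.prod (fun i => K3E_ev i hy) N).2.symm
  · apply tendsto_nhds_of_eventually_eq
    filter_upwards [K3G_eventually n] with N hN
    rw [hN]
  · simp only [norm_mul, Complex.norm_natCast]
    have := K3G_le n N
    gcongr

lemma cK3_eq (n : ℕ) : cK3 n = PowerSeries.coeff n (K3P ^ 24) := by
  have e : {f : Fin 24 → Σ m : ℕ, Nat.Partition m // ∑ i, (f i).1 = n} ≃
      Σ l : {l // l ∈ Finset.finsuppAntidiag (Finset.univ : Finset (Fin 24)) n},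
        ∀ i, Nat.Partition (l.1 i) :=
    { toFun := fun f => ⟨⟨Finsupp.equivFunOnFinite.symm fun i => (f.1 i).1, by
        simp [Finset.mem_finsuppAntidiag, f.2]⟩, fun i => (f.1 i).2⟩
      invFun := fun l => ⟨fun i => ⟨l.1.1 i, l.2 i⟩, by
        have := l.1.2
        rw [Finset.mem_finsuppAntidiag] at this
        exact this.1⟩
      left_inv := fun f => rfl
      right_inv := by
        rintro ⟨⟨l, hl⟩, g⟩
        obtain ⟨u, rfl⟩ : ∃ u, Finsupp.equivFunOnFinite.symm u = l :=
          ⟨_, Equiv.symm_apply_apply _ _⟩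
        rfl }
  have h : K3P ^ 24 = ∏ _i : Fin 24, K3P := by simp
  rw [cK3, Nat.card_congr e, Nat.card_sigma, h, PowerSeries.coeff_prod]
  refine Eq.trans ?_ (Finset.sum_coe_sort _ _)
  refine Finset.sum_congr rfl fun l _ => ?_
  rw [Nat.card_pi]
  simp [K3P]

lemma cK3_hasSum {y : ℂ} (hy : ‖y‖ < 1) :
    Multipliable (fun k : ℕ => ((1 - y ^ (k + 1)) ^ 24)⁻¹) ∧
    HasSum (fun n => (cK3 n : ℂ) * y ^ n) (∏' k : ℕ, ((1 - y ^ (k + 1)) ^ 24)⁻¹) := by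
  have h := (K3P_ev hy).pow 24
  have hm := (K3_mult hy).hasProd.pow 24
  simp only [inv_pow] at hm
  refine ⟨hm.multipliable, ?_⟩
  rw [hm.tprod_eq, ← h.2]
  simp only [cK3_eq]
  exact h.1.of_norm.hasSum

lemma K3_rootsum {ζ : ℂ} {d : ℕ} (hζ : IsPrimitiveRoot ζ d) (k : ℤ) :
    ∑ j ∈ Finset.range d, (ζ ^ k) ^ j = if (d : ℤ) ∣ k then (d : ℂ) else 0 := by
  split_ifs with h
  · rw [(hζ.zpow_eq_one_iff_dvd k).2 h]; simp
  · have h1 : ζ ^ k ≠ 1 := fun h' => h ((hζ.zpow_eq_one_iff_dvd k).1 h')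
    have h2 : (ζ ^ k) ^ d = 1 := by
      rw [← zpow_natCast, ← zpow_mul, mul_comm, zpow_mul, zpow_natCast, hζ.pow_eq_one, one_zpow]
    have h3 := mul_geom_sum (ζ ^ k) d
    rw [h2, sub_self] at h3
    exact (mul_eq_zero.1 h3).resolve_left (sub_ne_zero.2 h1)

lemma K3_norm {d : ℕ} {r : ℕ} (hr : 1 ≤ r) (hd : d ∣ r) {x : ℂ} (hx : ‖x‖ < 1) (j : ℕ) :
    ‖Complex.exp (2 * Real.pi * Complex.I / d) ^ j * x ^ (r ^ 3 / d ^ 2)‖ < 1 := by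
  have h1 : ‖Complex.exp (2 * Real.pi * Complex.I / d)‖ = 1 := by
    have : (2 * Real.pi * Complex.I / d : ℂ) = ((2 * Real.pi / d : ℝ) : ℂ) * Complex.I := by
      push_cast; ring
    rw [this, Complex.norm_exp_ofReal_mul_I]
  rw [norm_mul, norm_pow, norm_pow, h1, one_pow, one_mul]
  refine pow_lt_one₀ (norm_nonneg _) hx ?_
  have hd0 : 0 < d := Nat.pos_of_dvd_of_pos hd hr
  have : 0 < r ^ 3 / d ^ 2 := by
    apply Nat.div_pos _ (by positivity)
    calc d ^ 2 ≤ r ^ 2 := Nat.pow_le_pow_left (Nat.le_of_dvd hr hd) 2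
      _ ≤ r ^ 3 := Nat.pow_le_pow_right hr (by norm_num)
  omega

lemma K3_block (r e d : ℕ) (h : r = d * e) (hd : 0 < d) (he : 0 < e) (x : ℂ) (hx0 : x ≠ 0)
    (hx : ‖x‖ < 1) :
    HasSum (fun n : ℕ => if e ∣ n then (1 / (e : ℂ) ^ 2) *
        (cK3Z ((r : ℤ) * ((n : ℤ) - (r : ℤ)) / (e : ℤ) ^ 2 + 1) : ℂ) * x ^ (r ^ 2 * n) else 0)
      (((d : ℂ) / (r : ℂ) ^ 2) * x ^ (r ^ 3) *
            ∑ j ∈ Finset.range d,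
              (Complex.exp (2 * Real.pi * Complex.I / d) ^ j * x ^ (r ^ 3 / d ^ 2))⁻¹ *
                ∏' k : ℕ,
                  ((1 - (Complex.exp (2 * Real.pi * Complex.I / d) ^ j
                      * x ^ (r ^ 3 / d ^ 2)) ^ (k + 1)) ^ 24)⁻¹) := by
  have hr : 1 ≤ r := by rw [h]; exact Nat.mul_pos hd he
  have hζ := Complex.isPrimitiveRoot_exp d hd.ne'
  have hnorm := K3_norm hr (Dvd.intro _ h.symm : d ∣ r) hx
  have hpow : r ^ 3 / d ^ 2 = d * e ^ 3 := by
    rw [h]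
    exact Nat.div_eq_of_eq_mul_left (by positivity) (by ring)
  rw [hpow] at hnorm ⊢
  generalize Complex.exp (2 * Real.pi * Complex.I / d) = ζ at hζ hnorm ⊢
  have hζ0 : ζ ≠ 0 := hζ.ne_zero hd.ne'
  have hy0 : x ^ (d * e ^ 3) ≠ 0 := pow_ne_zero _ hx0
  generalize hy : x ^ (d * e ^ 3) = y at hnorm hy0 ⊢
  have h1 := hasSum_sum (s := Finset.range d) fun j _ =>
    (cK3_hasSum (hnorm j)).2.mul_left (ζ ^ j * y)⁻¹
  generalize (∑ j ∈ Finset.range d, (ζ ^ j * y)⁻¹ *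
    ∏' k : ℕ, ((1 - (ζ ^ j * y) ^ (k + 1)) ^ 24)⁻¹) = S at h1 ⊢
  have h2 : HasSum (fun m : ℤ => (cK3Z m : ℂ) * y ^ (m - 1) *
      (if (d : ℤ) ∣ m - 1 then (d : ℂ) else 0)) S := by
    rw [← Nat.cast_injective.hasSum_iff]
    · refine (congrArg (fun f => HasSum f S) (funext fun m => ?_)).mpr h1
      simp only [Function.comp_apply]
      rw [← K3_rootsum hζ, Finset.mul_sum]
      refine Finset.sum_congr rfl fun j _ => ?_
      have e1 : (ζ ^ ((m : ℤ) - 1)) ^ j = (ζ ^ j) ^ m * (ζ ^ j)⁻¹ := by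
        rw [← zpow_natCast, ← zpow_mul, mul_comm, zpow_mul, zpow_natCast,
          zpow_sub_one₀ (pow_ne_zero _ hζ0), zpow_natCast]
      rw [e1, zpow_sub_one₀ hy0, zpow_natCast, mul_inv, mul_pow]
      have : cK3Z (m : ℤ) = cK3 m := by simp [cK3Z]
      rw [this]
      ring
    · intro m hm
      have : ¬ 0 ≤ m := fun h0 => hm ⟨m.toNat, Int.toNat_of_nonneg h0⟩
      simp [cK3Z, this]
  have hdZ : (0 : ℤ) < d := by exact_mod_cast hd
  have h3 : HasSum (fun k : ℤ => (cK3Z (d * k + 1) : ℂ) * y ^ ((d : ℤ) * k) * (d : ℂ)) S := by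
    have hinj : Function.Injective (fun k : ℤ => (d : ℤ) * k + 1) := fun a b hab => by
      have : (d : ℤ) * a = d * b := by simpa using hab
      exact mul_left_cancel₀ hdZ.ne' this
    rw [← hinj.hasSum_iff] at h2
    · convert h2 using 1
      funext k
      simp
    · intro m hm
      have : ¬ (d : ℤ) ∣ m - 1 := fun ⟨k, hk⟩ => hm ⟨k, by simp only; rw [← hk]; ring⟩
      simp [this]
  have h4 : HasSum (fun t : ℤ => (cK3Z (d * (t - d) + 1) : ℂ) * y ^ ((d : ℤ) * (t - d)) * (d : ℂ))
      S := by
    rw [← (Equiv.subRight (d : ℤ)).hasSum_iff] at h3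
    exact h3
  have h5 : HasSum (fun t : ℕ => (cK3Z (d * ((t : ℤ) - d) + 1) : ℂ) *
      y ^ ((d : ℤ) * ((t : ℤ) - d)) * (d : ℂ)) S := by
    rw [← (Nat.cast_injective (R := ℤ)).hasSum_iff] at h4
    · exact h4
    · intro t ht
      have h0 : ¬ 0 ≤ t := fun h0 => ht ⟨t.toNat, Int.toNat_of_nonneg h0⟩
      have : ¬ (0 : ℤ) ≤ d * (t - d) + 1 := by
        have : (d : ℤ) * (t - d) ≤ d * (-2) := mul_le_mul_of_nonneg_left (by omega) hdZ.le
        omega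
      simp [cK3Z, this]
  have h6 := h5.mul_left (((d : ℂ) / (r : ℂ) ^ 2) * x ^ (r ^ 3))
  have hinj : Function.Injective (fun t : ℕ => e * t) := fun a b hab =>
    Nat.eq_of_mul_eq_mul_left he hab
  rw [← hinj.hasSum_iff]
  · refine (congrArg (fun f => HasSum f _) (funext fun t => ?_)).mpr h6
    simp only [Function.comp_apply, Dvd.intro, dvd_mul_right, if_true]
    have heZ : (e : ℤ) ≠ 0 := by exact_mod_cast he.ne'
    have heC : (e : ℂ) ≠ 0 := by exact_mod_cast he.ne'
    have hdC : (d : ℂ) ≠ 0 := by exact_mod_cast hd.ne'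
    have a1 : (r : ℤ) * (((e * t : ℕ) : ℤ) - r) / (e : ℤ) ^ 2 = d * ((t : ℤ) - d) := by
      apply Int.ediv_eq_of_eq_mul_left (pow_ne_zero _ heZ)
      rw [h]; push_cast; ring
    have a2 : x ^ (r ^ 2 * (e * t)) = x ^ (r ^ 3) * y ^ ((d : ℤ) * ((t : ℤ) - d)) := by
      rw [← hy, ← zpow_natCast, ← zpow_natCast, ← zpow_natCast, ← zpow_mul, ← zpow_add₀ hx0]
      congr 1
      rw [h]; push_cast; ring
    rw [a1, a2, h]
    push_cast
    field_simp
  · intro n hn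
    exact if_neg fun ⟨t, ht⟩ => hn ⟨t, ht.symm⟩

/-- the generating series of rank `r` trivial determinant Vafa–Witten
invariants of a K3 surface: for `0 < |x| < 1`,
`Σ_{n≥0} vw(r,n) x^{r²n}
  = Σ_{d ∣ r} (d/r²) x^{r³} Σ_{j=0}^{d−1} (ζ_d^j x^{r³/d²})⁻¹ ∏_{k≥1}(1−(ζ_d^j x^{r³/d²})^k)^{−24}`
with `ζ_d = exp(2πi/d)`, all series and products converging absolutely. -/
theorem statement12 (r : ℕ) (hr : 1 ≤ r) (x : ℂ) (hx0 : x ≠ 0) (hx : ‖x‖ < 1) :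
    Summable (fun n : ℕ => (vwK3 r n : ℂ) * x ^ (r ^ 2 * n)) ∧
    (∀ d ∈ r.divisors, ∀ j : ℕ, Multipliable fun k : ℕ =>
      ((1 - (Complex.exp (2 * Real.pi * Complex.I / d) ^ j * x ^ (r ^ 3 / d ^ 2)) ^ (k + 1))
          ^ 24)⁻¹) ∧
    ∑' n : ℕ, (vwK3 r n : ℂ) * x ^ (r ^ 2 * n)
      = ∑ d ∈ r.divisors,
          ((d : ℂ) / (r : ℂ) ^ 2) * x ^ (r ^ 3) *
            ∑ j ∈ Finset.range d,
              (Complex.exp (2 * Real.pi * Complex.I / d) ^ j * x ^ (r ^ 3 / d ^ 2))⁻¹ *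
                ∏' k : ℕ,
                  ((1 - (Complex.exp (2 * Real.pi * Complex.I / d) ^ j
                      * x ^ (r ^ 3 / d ^ 2)) ^ (k + 1)) ^ 24)⁻¹ := by
  have hr0 : r ≠ 0 := by omega
  have hterm : ∀ n : ℕ, (vwK3 r n : ℂ) * x ^ (r ^ 2 * n) =
      ∑ d ∈ r.divisors, (if (r / d) ∣ n then (1 / ((r / d : ℕ) : ℂ) ^ 2) *
        (cK3Z ((r : ℤ) * ((n : ℤ) - (r : ℤ)) / ((r / d : ℕ) : ℤ) ^ 2 + 1) : ℂ)
          * x ^ (r ^ 2 * n) else 0) := by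
    intro n
    rw [Nat.sum_div_divisors r (fun e => if e ∣ n then (1 / (e : ℂ) ^ 2) *
        (cK3Z ((r : ℤ) * ((n : ℤ) - (r : ℤ)) / (e : ℤ) ^ 2 + 1) : ℂ)
          * x ^ (r ^ 2 * n) else 0), ← Finset.sum_filter]
    have hset : (Nat.gcd r n).divisors = r.divisors.filter (fun e => e ∣ n) := by
      ext e
      simp [Nat.mem_divisors, Nat.dvd_gcd_iff, hr0]
    rw [vwK3, hset]
    push_cast
    rw [Finset.sum_mul]
  have hmain := hasSum_sum (s := r.divisors) fun d hd => K3_block r (r / d) d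
      (Nat.mul_div_cancel' (Nat.dvd_of_mem_divisors hd)).symm (Nat.pos_of_mem_divisors hd)
      (Nat.div_pos (Nat.divisor_le hd) (Nat.pos_of_mem_divisors hd)) x hx0 hx
  simp only [← hterm] at hmain
  exact ⟨hmain.summable,
    fun d hd j => (cK3_hasSum (K3_norm hr (Nat.dvd_of_mem_divisors hd) hx j)).1, hmain.tsum_eq⟩
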